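/- arXiv:2211.13132 — 2 statements merged into one kernel-verified Lean document; each statement's English description precedes it below -/
import Mathlib

section
/- If D_ℓ(z)(ω) ≥ D_ℓ(z')(ω) for μ-a.e. ω and every ℓ = 1,…,L (one direction of uniform unordered monotonicity), then for every ℓ: (a) μ(F_ℓ) = 0 and μ(C_ℓ) = P_ℓ(z) − P_ℓ(z'); and (b) the reduced form satisfies R = Σ_{ℓ=1}^L ∫_{C_ℓ} (Y(ℓ) − Y(0)) dμ = Σ_{ℓ=1}^L (P_ℓ(z) − P_ℓ(z'))·E[Y(ℓ) − Y(0) | C_ℓ], where a term is understood as zero when μ(C_ℓ) = 0. -/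
open MeasureTheory ProbabilityTheory

/-- If D_ℓ(z) ≥ D_ℓ(z') a.e. for every ℓ (one direction of uniform unordered
monotonicity), then for every ℓ: (a) μ(F_ℓ) = 0 and μ(C_ℓ) = P_ℓ(z) − P_ℓ(z'); and
(b) R = Σ_ℓ ∫_{C_ℓ} (Y(ℓ) − Y(0)) dμ = Σ_ℓ (P_ℓ(z) − P_ℓ(z'))·E[Y(ℓ) − Y(0) | C_ℓ],
a term understood as zero when μ(C_ℓ) = 0 (here E[X|A] = (μ A).toReal⁻¹ ∫_A X dμ, which is
zero by the convention (0 : ℝ)⁻¹ = 0 when μ(A) = 0). -/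
theorem monotone_reduced_form_decomposition
    {Ω : Type*} [MeasurableSpace Ω] (μ : Measure Ω) [IsProbabilityMeasure μ]
    (L : ℕ) (hL : 1 ≤ L)
    (Dz Dz' : Fin L → Ω → ℝ)
    (hDzMeas : ∀ ℓ, Measurable (Dz ℓ))
    (hDz'Meas : ∀ ℓ, Measurable (Dz' ℓ))
    (hDz01 : ∀ ℓ ω, Dz ℓ ω = 0 ∨ Dz ℓ ω = 1)
    (hDz'01 : ∀ ℓ ω, Dz' ℓ ω = 0 ∨ Dz' ℓ ω = 1)
    (hDzExcl : ∀ ω, (∑ ℓ, Dz ℓ ω) ≤ 1)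
    (hDz'Excl : ∀ ω, (∑ ℓ, Dz' ℓ ω) ≤ 1)
    (Y0 : Ω → ℝ) (Yt : Fin L → Ω → ℝ)
    (hY0 : Integrable Y0 μ) (hYt : ∀ ℓ, Integrable (Yt ℓ) μ)
    -- uniform unordered monotonicity (one direction)
    (hmono : ∀ ℓ, ∀ᵐ ω ∂μ, Dz' ℓ ω ≤ Dz ℓ ω) :
    (∀ ℓ, μ {ω | Dz ℓ ω = 0 ∧ Dz' ℓ ω = 1} = 0)
      ∧ (∀ ℓ, (μ {ω | Dz ℓ ω = 1 ∧ Dz' ℓ ω = 0}).toReal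
          = (∫ ω, Dz ℓ ω ∂μ) - (∫ ω, Dz' ℓ ω ∂μ))
      ∧ (∫ ω, (∑ ℓ, (Dz ℓ ω - Dz' ℓ ω) * (Yt ℓ ω - Y0 ω)) ∂μ
          = ∑ ℓ, ∫ ω in {ω | Dz ℓ ω = 1 ∧ Dz' ℓ ω = 0}, (Yt ℓ ω - Y0 ω) ∂μ)
      ∧ (∫ ω, (∑ ℓ, (Dz ℓ ω - Dz' ℓ ω) * (Yt ℓ ω - Y0 ω)) ∂μ
          = ∑ ℓ, ((∫ ω, Dz ℓ ω ∂μ) - (∫ ω, Dz' ℓ ω ∂μ))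
            * ((μ {ω | Dz ℓ ω = 1 ∧ Dz' ℓ ω = 0}).toReal⁻¹
              * ∫ ω in {ω | Dz ℓ ω = 1 ∧ Dz' ℓ ω = 0}, (Yt ℓ ω - Y0 ω) ∂μ)) := by
  have hC : ∀ ℓ, MeasurableSet {ω | Dz ℓ ω = 1 ∧ Dz' ℓ ω = 0} := fun ℓ =>
    (hDzMeas ℓ (measurableSet_singleton 1)).inter (hDz'Meas ℓ (measurableSet_singleton 0))
  have key : ∀ ℓ (g : Ω → ℝ), (fun ω => (Dz ℓ ω - Dz' ℓ ω) * g ω) =ᵐ[μ]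
      Set.indicator {ω | Dz ℓ ω = 1 ∧ Dz' ℓ ω = 0} g := by
    intro ℓ g
    filter_upwards [hmono ℓ] with ω hω
    rcases hDz01 ℓ ω with h | h <;> rcases hDz'01 ℓ ω with h' | h'
    · simp [Set.indicator, h, h']
    · rw [h, h'] at hω
      norm_num at hω
    · simp [Set.indicator, h, h']
    · simp [Set.indicator, h, h']
  have hint : ∀ D : Ω → ℝ, Measurable D → (∀ ω, D ω = 0 ∨ D ω = 1) → Integrable D μ := by
    intro D hD h01
    refine Integrable.of_bound hD.aestronglyMeasurable 1 (Filter.Eventually.of_forall fun ω => ?_)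
    rcases h01 ω with h | h <;> simp [h]
  have hP : ∀ ℓ, (μ {ω | Dz ℓ ω = 1 ∧ Dz' ℓ ω = 0}).toReal
          = (∫ ω, Dz ℓ ω ∂μ) - (∫ ω, Dz' ℓ ω ∂μ) := by
    intro ℓ
    rw [← integral_sub (hint _ (hDzMeas ℓ) (hDz01 ℓ)) (hint _ (hDz'Meas ℓ) (hDz'01 ℓ))]
    have h := integral_congr_ae (key ℓ (fun _ => 1))
    rw [integral_indicator (hC ℓ)] at h
    simp only [mul_one] at h
    rw [h]
    simp [Measure.real]
  have hR : ∫ ω, (∑ ℓ, (Dz ℓ ω - Dz' ℓ ω) * (Yt ℓ ω - Y0 ω)) ∂μ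
          = ∑ ℓ, ∫ ω in {ω | Dz ℓ ω = 1 ∧ Dz' ℓ ω = 0}, (Yt ℓ ω - Y0 ω) ∂μ := by
    rw [integral_finsetSum]
    · refine Finset.sum_congr rfl fun ℓ _ => ?_
      rw [integral_congr_ae (key ℓ (fun ω => Yt ℓ ω - Y0 ω)), integral_indicator (hC ℓ)]
    · intro ℓ _
      exact (((hYt ℓ).sub hY0).indicator (hC ℓ)).congr (key ℓ (fun ω => Yt ℓ ω - Y0 ω)).symm
  refine ⟨fun ℓ => ?_, hP, hR, ?_⟩
  · refine measure_mono_null ?_ (ae_iff.1 (hmono ℓ))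
    rintro ω ⟨h, h'⟩
    simp [h, h']
  · rw [hR]
    refine Finset.sum_congr rfl fun ℓ _ => ?_
    rw [← hP ℓ]
    by_cases h0 : μ {ω | Dz ℓ ω = 1 ∧ Dz' ℓ ω = 0} = 0
    · rw [setIntegral_measure_zero _ h0]
      simp
    · rw [mul_inv_cancel_left₀ (ENNReal.toReal_ne_zero.2 ⟨h0, measure_ne_top _ _⟩)]
end

section
/- Under net uniform unordered monotonicity, the defier contributions cancel and the reduced form equals the sum of surviving-complier contributions: R = Σ_{ℓ=1}^L ∫_{C^s_ℓ} (Y(ℓ) − Y(0)) dμ = Σ_{ℓ=1}^L μ(C^s_ℓ)·E[Y(ℓ) − Y(0) | C^s_ℓ], where a term is understood as zero when μ(C^s_ℓ) = 0. -/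
open MeasureTheory ProbabilityTheory

/-- Under net uniform unordered monotonicity (for every ℓ there is a
measurable C^f_ℓ ⊆ C_ℓ with μ(C^f_ℓ) = μ(F_ℓ) and equal integrated treatment effects
over C^f_ℓ and F_ℓ), the defier contributions cancel and
R = Σ_ℓ ∫_{C^s_ℓ} (Y(ℓ) − Y(0)) dμ = Σ_ℓ μ(C^s_ℓ)·E[Y(ℓ) − Y(0) | C^s_ℓ],
where C^s_ℓ = C_ℓ \ C^f_ℓ and a term is zero when μ(C^s_ℓ) = 0. -/
theorem net_monotonicity_reduced_form
    {Ω : Type*} [MeasurableSpace Ω] (μ : Measure Ω) [IsProbabilityMeasure μ]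
    (L : ℕ) (hL : 1 ≤ L)
    (Dz Dz' : Fin L → Ω → ℝ)
    (hDzMeas : ∀ ℓ, Measurable (Dz ℓ))
    (hDz'Meas : ∀ ℓ, Measurable (Dz' ℓ))
    (hDz01 : ∀ ℓ ω, Dz ℓ ω = 0 ∨ Dz ℓ ω = 1)
    (hDz'01 : ∀ ℓ ω, Dz' ℓ ω = 0 ∨ Dz' ℓ ω = 1)
    (hDzExcl : ∀ ω, (∑ ℓ, Dz ℓ ω) ≤ 1)
    (hDz'Excl : ∀ ω, (∑ ℓ, Dz' ℓ ω) ≤ 1)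
    (Y0 : Ω → ℝ) (Yt : Fin L → Ω → ℝ)
    (hY0 : Integrable Y0 μ) (hYt : ∀ ℓ, Integrable (Yt ℓ) μ)
    -- Condition 7: net uniform unordered monotonicity
    (Cf : Fin L → Set Ω)
    (hCfMeas : ∀ ℓ, MeasurableSet (Cf ℓ))
    (hCfSub : ∀ ℓ, Cf ℓ ⊆ {ω | Dz ℓ ω = 1 ∧ Dz' ℓ ω = 0})
    (hCfFreq : ∀ ℓ, μ (Cf ℓ) = μ {ω | Dz ℓ ω = 0 ∧ Dz' ℓ ω = 1})
    (hCfEffect : ∀ ℓ, (∫ ω in Cf ℓ, (Yt ℓ ω - Y0 ω) ∂μ)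
      = ∫ ω in {ω | Dz ℓ ω = 0 ∧ Dz' ℓ ω = 1}, (Yt ℓ ω - Y0 ω) ∂μ) :
    (∫ ω, (∑ ℓ, (Dz ℓ ω - Dz' ℓ ω) * (Yt ℓ ω - Y0 ω)) ∂μ
        = ∑ ℓ, ∫ ω in {ω | Dz ℓ ω = 1 ∧ Dz' ℓ ω = 0} \ Cf ℓ, (Yt ℓ ω - Y0 ω) ∂μ)
      ∧ ∫ ω, (∑ ℓ, (Dz ℓ ω - Dz' ℓ ω) * (Yt ℓ ω - Y0 ω)) ∂μ
        = ∑ ℓ, (μ ({ω | Dz ℓ ω = 1 ∧ Dz' ℓ ω = 0} \ Cf ℓ)).toReal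
          * ((μ ({ω | Dz ℓ ω = 1 ∧ Dz' ℓ ω = 0} \ Cf ℓ)).toReal⁻¹
            * ∫ ω in {ω | Dz ℓ ω = 1 ∧ Dz' ℓ ω = 0} \ Cf ℓ, (Yt ℓ ω - Y0 ω) ∂μ) := by
  have key : ∫ ω, (∑ ℓ, (Dz ℓ ω - Dz' ℓ ω) * (Yt ℓ ω - Y0 ω)) ∂μ
        = ∑ ℓ, ∫ ω in {ω | Dz ℓ ω = 1 ∧ Dz' ℓ ω = 0} \ Cf ℓ, (Yt ℓ ω - Y0 ω) ∂μ := by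
    have hC : ∀ ℓ, MeasurableSet {ω | Dz ℓ ω = 1 ∧ Dz' ℓ ω = 0} := fun ℓ =>
      (hDzMeas ℓ (measurableSet_singleton 1)).inter (hDz'Meas ℓ (measurableSet_singleton 0))
    have hF : ∀ ℓ, MeasurableSet {ω | Dz ℓ ω = 0 ∧ Dz' ℓ ω = 1} := fun ℓ =>
      (hDzMeas ℓ (measurableSet_singleton 0)).inter (hDz'Meas ℓ (measurableSet_singleton 1))
    have hI : ∀ ℓ, Integrable (fun ω => Yt ℓ ω - Y0 ω) μ := fun ℓ => (hYt ℓ).sub hY0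
    have hpt : ∀ ℓ, (fun ω => (Dz ℓ ω - Dz' ℓ ω) * (Yt ℓ ω - Y0 ω))
        = fun ω => Set.indicator {ω | Dz ℓ ω = 1 ∧ Dz' ℓ ω = 0} (fun ω => Yt ℓ ω - Y0 ω) ω
          - Set.indicator {ω | Dz ℓ ω = 0 ∧ Dz' ℓ ω = 1} (fun ω => Yt ℓ ω - Y0 ω) ω := by
      intro ℓ
      funext ω
      rcases hDz01 ℓ ω with h | h <;> rcases hDz'01 ℓ ω with h' | h' <;>
        simp [Set.indicator, h, h']
    rw [integral_finsetSum]
    · refine Finset.sum_congr rfl fun ℓ _ => ?_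
      rw [hpt ℓ, integral_sub ((hI ℓ).indicator (hC ℓ)) ((hI ℓ).indicator (hF ℓ)),
        integral_indicator (hC ℓ), integral_indicator (hF ℓ), ← hCfEffect ℓ,
        setIntegral_diff (hCfMeas ℓ) (hI ℓ).integrableOn (hCfSub ℓ)]
    · intro ℓ _
      rw [hpt ℓ]
      exact ((hI ℓ).indicator (hC ℓ)).sub ((hI ℓ).indicator (hF ℓ))
  refine ⟨key, key.trans (Finset.sum_congr rfl fun ℓ _ => ?_)⟩
  by_cases h : (μ ({ω | Dz ℓ ω = 1 ∧ Dz' ℓ ω = 0} \ Cf ℓ)).toReal = 0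
  · have h0 : μ ({ω | Dz ℓ ω = 1 ∧ Dz' ℓ ω = 0} \ Cf ℓ) = 0 :=
      ((ENNReal.toReal_eq_zero_iff _).1 h).resolve_right (measure_ne_top _ _)
    rw [h, zero_mul, Measure.restrict_eq_zero.2 h0, integral_zero_measure]
  · rw [mul_inv_cancel_left₀ h]
end
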